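/- Fix a reduced word (i_1,…,i_ν) of w₀. If H and H′ in 𝒰(K_+) admit descent chains along (i_1,…,i_ν), both ending at H_{ν+1} = i_1^0 i_2^0 ⋯ i_ν^0, with the same tuple (c_1,…,c_ν)∈K_+^ν, then H = H′. (Hence the map ζ_{(i_1,…,i_ν)} sending H∈𝒰(K_+) to the tuple of its descent chain along (i_1,…,i_ν) is injective.) -/

import Mathlib

open FreeMonoid

/-- The minimum of two elements of an additive subgroup of `ℝ`
(the "sum" in the tropical semifield `K`). -/
noncomputable def kmin {K : AddSubgroup ℝ} (a b : K) : K :=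
  if (a : ℝ) ≤ (b : ℝ) then a else b

/-- Defining relations of the monoid `𝔘(K)` attached to a simply laced Coxeter matrix `M`
and the tropical semifield `K` (a subgroup of `(ℝ, +)` with sum `min` and product `+`). -/
inductive UKRel {I : Type*} (M : CoxeterMatrix I) (K : AddSubgroup ℝ) :
    FreeMonoid (I × K) → FreeMonoid (I × K) → Prop
  | comm (i j : I) (h : M i j = 2) (a b : K) :
      UKRel M K (of (i, a) * of (j, b)) (of (j, b) * of (i, a))
  | braid (i j : I) (h : M i j = 3) (a b c : K) :
      UKRel M K (of (i, a) * of (j, b) * of (i, c))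
        (of (j, b + c - kmin a c) * of (i, kmin a c) * of (j, a + b - kmin a c))
  | idem (i : I) (a b : K) :
      UKRel M K (of (i, a) * of (i, b)) (of (i, kmin a b))

/-- The monoid `𝔘(K)`. -/
noncomputable def UK {I : Type*} (M : CoxeterMatrix I) (K : AddSubgroup ℝ) :=
  (conGen (UKRel M K)).Quotient

noncomputable instance {I : Type*} (M : CoxeterMatrix I) (K : AddSubgroup ℝ) :
    Monoid (UK M K) := Con.monoid _

/-- The generator `i^a` of `𝔘(K)`. -/
noncomputable def genU {I : Type*} (M : CoxeterMatrix I) (K : AddSubgroup ℝ)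
    (i : I) (a : K) : UK M K :=
  (Con.mk' _) (of (i, a))

/-- The product `i₁^{a₁} ⋯ i_n^{a_n}` in `𝔘(K)` associated to a list of pairs. -/
noncomputable def prodU {I : Type*} (M : CoxeterMatrix I) (K : AddSubgroup ℝ)
    (ω : List (I × K)) : UK M K :=
  (ω.map fun p => genU M K p.1 p.2).prod

/-- `l` is a reduced word of `w`. -/
def IsRedWord {I W : Type*} [Group W] {M : CoxeterMatrix I} (cs : CoxeterSystem M W)
    (w : W) (l : List I) : Prop :=
  cs.wordProd l = w ∧ l.length = cs.length w

/-- The set `𝒰(K) = 𝔘_{w₀}(K)` of products over reduced words of `w₀`. -/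
noncomputable def calU {I W : Type*} [Group W] (M : CoxeterMatrix I) (K : AddSubgroup ℝ)
    (cs : CoxeterSystem M W) (w₀ : W) : Set (UK M K) :=
  {u | ∃ ω : List (I × K), IsRedWord cs w₀ (ω.map Prod.fst) ∧ u = prodU M K ω}

/-- The set `𝒰(K₊)`: products over reduced words of `w₀` with coefficients in `K₊ = K ∩ ℝ≥0`. -/
noncomputable def calUplus {I W : Type*} [Group W] (M : CoxeterMatrix I) (K : AddSubgroup ℝ)
    (cs : CoxeterSystem M W) (w₀ : W) : Set (UK M K) :=
  {u | ∃ ω : List (I × K), IsRedWord cs w₀ (ω.map Prod.fst) ∧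
        (∀ p ∈ ω, 0 ≤ (p.2 : ℝ)) ∧ u = prodU M K ω}

/-- Two vertices of the graph on `𝒰(K)` are joined by an edge. -/
noncomputable def UEdge {I W : Type*} [Group W] (M : CoxeterMatrix I) (K : AddSubgroup ℝ)
    (cs : CoxeterSystem M W) (w₀ : W) (H H' : UK M K) : Prop :=
  H ≠ H' ∧ ∃ (i : I) (b b' : K) (ω : List (I × K)),
    IsRedWord cs w₀ (i :: ω.map Prod.fst) ∧
    H = genU M K i b * prodU M K ω ∧ H' = genU M K i b' * prodU M K ω

/-- `H` and `H'` are at distance `≤ k` in the graph on `𝒰(K)`. -/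
noncomputable def DistLE {I W : Type*} [Group W] (M : CoxeterMatrix I) (K : AddSubgroup ℝ)
    (cs : CoxeterSystem M W) (w₀ : W) (k : ℕ) (H H' : UK M K) : Prop :=
  ∃ f : ℕ → UK M K, f 0 = H ∧ f k = H' ∧ (∀ t ≤ k, f t ∈ calU M K cs w₀) ∧
    ∀ t < k, f t = f (t + 1) ∨ UEdge M K cs w₀ (f t) (f (t + 1))

/-- A descent chain for `H ∈ 𝒰(K₊)` along a reduced word `l` of `w₀`: a sequence
`H = Hs 0, Hs 1, …, Hs l.length` in `𝒰(K₊)` together with a tuple `c` in `K₊` such that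
at each step `k`, for some reduced word of `w₀` beginning with `l.get k` and some
coefficients in `K₊`, `Hs k = (l.get k)^{c k} · j₂^{a₂} ⋯ j_ν^{a_ν}` and
`Hs (k+1) = (l.get k)^{0} · j₂^{a₂} ⋯ j_ν^{a_ν}`. -/
noncomputable def DescentChain {I W : Type*} [Group W] (M : CoxeterMatrix I)
    (K : AddSubgroup ℝ) (cs : CoxeterSystem M W) (w₀ : W)
    (l : List I) (H : UK M K) (Hs : ℕ → UK M K) (c : ℕ → K) : Prop :=
  Hs 0 = H ∧
  (∀ k ≤ l.length, Hs k ∈ calUplus M K cs w₀) ∧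
  (∀ k < l.length, 0 ≤ (c k : ℝ)) ∧
  ∀ (k : ℕ) (hk : k < l.length), ∃ ω : List (I × K),
    (∀ p ∈ ω, 0 ≤ (p.2 : ℝ)) ∧
    IsRedWord cs w₀ (l.get ⟨k, hk⟩ :: ω.map Prod.fst) ∧
    Hs k = genU M K (l.get ⟨k, hk⟩) (c k) * prodU M K ω ∧
    Hs (k + 1) = genU M K (l.get ⟨k, hk⟩) 0 * prodU M K ω

/-! ### The geometric representation of a simply laced Coxeter group -/

section Coxeter

variable {I W : Type*} [Group W] {M : CoxeterMatrix I}

/-- The negative of the Cartan integer attached to `i` and `k`. -/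
def negCartan (M : CoxeterMatrix I) (i k : I) : ℤ :=
  if M i k = 1 then -2 else if M i k = 3 then 1 else 0

lemma negCartan_self (M : CoxeterMatrix I) (i : I) : negCartan M i i = -2 := by
  simp [negCartan]

lemma negCartan_of_eq_two {i k : I} (h : M i k = 2) : negCartan M i k = 0 := by
  simp [negCartan, h]

lemma negCartan_of_eq_three {i k : I} (h : M i k = 3) : negCartan M i k = 1 := by
  simp [negCartan, h]

/-- The simple reflection attached to `i`, in the coordinates given by the simple roots. -/
def simpleReflection (M : CoxeterMatrix I) (i : I) (c : I → ℝ) : I → ℝ :=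
  fun k => c k + negCartan M i k * c i

lemma simpleReflection_involutive (M : CoxeterMatrix I) (i : I) :
    Function.Involutive (simpleReflection M i) := by
  intro c
  funext k
  simp only [simpleReflection, negCartan_self]
  push_cast
  ring

/-- A simply laced Coxeter matrix: distinct entries are `2` or `3`. -/
def IsSimplyLaced (M : CoxeterMatrix I) : Prop := ∀ i j : I, i ≠ j → M i j = 2 ∨ M i j = 3

lemma isLiftable_simpleReflection (hM : IsSimplyLaced M) :
    M.IsLiftable fun i => (simpleReflection_involutive M i).toPerm := by
  intro i j
  by_cases hij : i = j
  · subst hij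
    rw [M.diagonal, pow_one]
    exact Equiv.ext fun c => simpleReflection_involutive M i c
  · have hji : M j i = M i j := M.symmetric j i
    rcases hM i j hij with h | h
    · rw [h]
      have h' := hji.trans h
      refine Equiv.ext fun c => funext fun k => ?_
      simp [pow_succ, simpleReflection, negCartan_self, negCartan_of_eq_two h,
        negCartan_of_eq_two h']
      ring
    · rw [h]
      have h' := hji.trans h
      refine Equiv.ext fun c => funext fun k => ?_
      simp [pow_succ, simpleReflection, negCartan_self, negCartan_of_eq_three h,
        negCartan_of_eq_three h']
      ring

/-- The geometric representation, in coordinates given by the simple roots. -/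
noncomputable def geomRep (cs : CoxeterSystem M W) (hM : IsSimplyLaced M) :
    W →* Equiv.Perm (I → ℝ) :=
  cs.lift ⟨_, isLiftable_simpleReflection hM⟩

/-- The `W`-translate of the vector on which all simple roots take the value `1`. -/
noncomputable def rhoOrbit (cs : CoxeterSystem M W) (hM : IsSimplyLaced M) (w : W) : I → ℝ :=
  geomRep cs hM w fun _ => 1

lemma rhoOrbit_one (cs : CoxeterSystem M W) (hM : IsSimplyLaced M) (k : I) :
    rhoOrbit cs hM 1 k = 1 := by
  simp [rhoOrbit]

lemma rhoOrbit_simple_mul (cs : CoxeterSystem M W) (hM : IsSimplyLaced M) (i : I) (w : W) :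
    rhoOrbit cs hM (cs.simple i * w) = simpleReflection M i (rhoOrbit cs hM w) := by
  rw [rhoOrbit, map_mul, geomRep, cs.lift_apply_simple]
  rfl

lemma rhoOrbit_simple_mul_self (cs : CoxeterSystem M W) (hM : IsSimplyLaced M) (i : I) (w : W) :
    rhoOrbit cs hM (cs.simple i * w) i = -rhoOrbit cs hM w i := by
  simp only [rhoOrbit_simple_mul, simpleReflection, negCartan_self]
  push_cast
  ring

lemma rhoOrbit_simple_mul_of_eq_two (cs : CoxeterSystem M W) (hM : IsSimplyLaced M) {i j : I}
    (h : M i j = 2) (w : W) :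
    rhoOrbit cs hM (cs.simple i * w) j = rhoOrbit cs hM w j := by
  simp [rhoOrbit_simple_mul, simpleReflection, negCartan_of_eq_two h]

lemma rhoOrbit_simple_mul_of_eq_three (cs : CoxeterSystem M W) (hM : IsSimplyLaced M) {i j : I}
    (h : M i j = 3) (w : W) :
    rhoOrbit cs hM (cs.simple i * w) j = rhoOrbit cs hM w j + rhoOrbit cs hM w i := by
  simp [rhoOrbit_simple_mul, simpleReflection, negCartan_of_eq_three h]

lemma simple_mul_simple_mul_of_eq_two (cs : CoxeterSystem M W) {i j : I} (h : M i j = 2) (w : W) :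
    cs.simple i * (cs.simple j * w) = cs.simple j * (cs.simple i * w) := by
  have h2 := cs.simple_mul_simple_pow i j
  rw [h, pow_two, mul_eq_one_iff_eq_inv, mul_inv_rev, cs.inv_simple, cs.inv_simple] at h2
  rw [← mul_assoc, h2, mul_assoc]

lemma simple_mul_simple_mul_of_eq_three (cs : CoxeterSystem M W) {i j : I} (h : M i j = 3)
    (w : W) :
    cs.simple i * (cs.simple j * (cs.simple i * w)) =
      cs.simple j * (cs.simple i * (cs.simple j * w)) := by
  have h3 := cs.simple_mul_simple_pow i j
  rw [h] at h3
  have key : cs.simple i * cs.simple j * cs.simple i =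
      cs.simple j * cs.simple i * cs.simple j := by
    have : (cs.simple i * cs.simple j * cs.simple i) *
        (cs.simple j * cs.simple i * cs.simple j) = 1 := by
      rw [← h3]; simp only [pow_succ, pow_zero, one_mul, mul_assoc]
    rw [mul_eq_one_iff_eq_inv] at this
    rw [this]
    simp [mul_assoc]
  simpa [mul_assoc] using congrArg (· * w) key

/-- A simple root that is not a left descent is positive on the corresponding chamber. -/
theorem rhoOrbit_pos (cs : CoxeterSystem M W) (hM : IsSimplyLaced M) :
    ∀ (n : ℕ) (w : W), cs.length w = n → ∀ i, ¬ cs.IsLeftDescent w i →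
      0 < rhoOrbit cs hM w i := by
  intro n
  induction n using Nat.strong_induction_on with
  | _ n ih =>
  intro w hw i hi
  by_cases hw1 : w = 1
  · subst hw1; simp [rhoOrbit_one]
  obtain ⟨j, hj⟩ := cs.exists_leftDescent_of_ne_one hw1
  have hij : i ≠ j := by rintro rfl; exact hi hj
  obtain ⟨v, rfl⟩ : ∃ v, w = cs.simple j * v := ⟨cs.simple j * w, by simp⟩
  have hlv : cs.length v + 1 = cs.length (cs.simple j * v) := by
    simpa using cs.isLeftDescent_iff.1 hj
  have hnd : ¬ cs.IsLeftDescent v j := by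
    rw [cs.not_isLeftDescent_iff]; exact hlv.symm
  rw [cs.not_isLeftDescent_iff] at hi
  have hle (k : I) (x : W) : cs.length (cs.simple k * x) ≤ cs.length x + 1 := by
    rcases cs.length_simple_mul x k with h | h <;> omega
  rcases hM j i hij.symm with h | h
  · rw [rhoOrbit_simple_mul_of_eq_two cs hM h]
    refine ih _ (by omega) v rfl i fun hd => ?_
    rw [cs.isLeftDescent_iff] at hd
    rw [← simple_mul_simple_mul_of_eq_two cs h] at hi
    have := hle j (cs.simple i * v)
    omega
  · rw [rhoOrbit_simple_mul_of_eq_three cs hM h]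
    have hvj := ih _ (by omega) v rfl j hnd
    by_cases hd : cs.IsLeftDescent v i
    · obtain ⟨u, rfl⟩ : ∃ u, v = cs.simple i * u := ⟨cs.simple i * v, by simp⟩
      have hlu : cs.length u + 1 = cs.length (cs.simple i * u) := by
        simpa using cs.isLeftDescent_iff.1 hd
      have h' : M i j = 3 := (M.symmetric i j).trans h
      rw [rhoOrbit_simple_mul_self, rhoOrbit_simple_mul_of_eq_three cs hM h']
      have : 0 < rhoOrbit cs hM u j := by
        refine ih _ (by omega) u rfl j fun hd' => ?_
        rw [cs.isLeftDescent_iff] at hd'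
        rw [simple_mul_simple_mul_of_eq_three cs h'] at hi
        have h1 := hle j (cs.simple i * (cs.simple j * u))
        have h2 := hle i (cs.simple j * u)
        omega
      linarith
    · have := ih _ (by omega) v rfl i hd
      linarith

theorem rhoOrbit_neg_iff (cs : CoxeterSystem M W) (hM : IsSimplyLaced M) {w : W} {i : I} :
    rhoOrbit cs hM w i < 0 ↔ cs.IsLeftDescent w i := by
  constructor
  · intro h
    by_contra hd
    exact absurd (rhoOrbit_pos cs hM _ w rfl i hd) h.not_gt
  · intro h
    have := rhoOrbit_pos cs hM _ _ rfl i (cs.isLeftDescent_iff_not_isLeftDescent_mul.1 h)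
    rw [rhoOrbit_simple_mul_self] at this
    linarith

lemma isReduced_cons_iff (cs : CoxeterSystem M W) {i : I} {l : List I} :
    cs.IsReduced (i :: l) ↔
      cs.IsReduced l ∧ ¬ cs.IsLeftDescent (cs.wordProd l) i := by
  rw [cs.not_isLeftDescent_iff]
  simp only [CoxeterSystem.IsReduced, cs.wordProd_cons, List.length_cons]
  have h1 := cs.length_wordProd_le l
  constructor
  · intro h
    rcases cs.length_simple_mul (cs.wordProd l) i with h2 | h2 <;> omega
  · rintro ⟨h, h'⟩
    omega

lemma exists_isReduced_cons (cs : CoxeterSystem M W) {w : W} {i : I}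
    (h : cs.IsLeftDescent w i) :
    ∃ l, cs.IsReduced (i :: l) ∧ cs.wordProd (i :: l) = w := by
  obtain ⟨l, hl, hw⟩ := cs.exists_isReduced (cs.simple i * w)
  refine ⟨l, (isReduced_cons_iff cs).2 ⟨hl, ?_⟩, ?_⟩
  · rw [← hw]; exact cs.isLeftDescent_iff_not_isLeftDescent_mul.1 h
  · rw [cs.wordProd_cons, ← hw]; simp

end Coxeter

/-! ### Matsumoto's theorem and transport of exponents between reduced words -/

section Transport

variable {I W : Type*} [Group W] {M : CoxeterMatrix I} {K : AddSubgroup ℝ}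

lemma prodU_cons (p : I × K) (ω : List (I × K)) :
    prodU M K (p :: ω) = genU M K p.1 p.2 * prodU M K ω := by
  simp [prodU]

lemma genU_mul_comm {i j : I} (h : M i j = 2) (a b : K) :
    genU M K i a * genU M K j b = genU M K j b * genU M K i a :=
  (Con.eq _).2 (ConGen.Rel.of _ _ (UKRel.comm i j h a b))

lemma genU_braid {i j : I} (h : M i j = 3) (a b c : K) :
    genU M K i a * genU M K j b * genU M K i c =
      genU M K j (b + c - kmin a c) * genU M K i (kmin a c) *
        genU M K j (a + b - kmin a c) :=
  (Con.eq _).2 (ConGen.Rel.of _ _ (UKRel.braid i j h a b c))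

variable (M K) in
/-- Every product in `𝔘(K)` along `l` is also a product along `l'`. -/
def TransportsTo (l l' : List I) : Prop :=
  ∀ ω : List (I × K), ω.map Prod.fst = l →
    ∃ ω' : List (I × K), ω'.map Prod.fst = l' ∧ prodU M K ω' = prodU M K ω

lemma TransportsTo.trans {l₁ l₂ l₃ : List I} (h : TransportsTo M K l₁ l₂)
    (h' : TransportsTo M K l₂ l₃) : TransportsTo M K l₁ l₃ := by
  intro ω hω
  obtain ⟨ω', h1, h2⟩ := h ω hω
  obtain ⟨ω'', h3, h4⟩ := h' ω' h1
  exact ⟨ω'', h3, h4.trans h2⟩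

lemma TransportsTo.cons {l l' : List I} (h : TransportsTo M K l l') (i : I) :
    TransportsTo M K (i :: l) (i :: l') := by
  intro ω hω
  obtain ⟨p, ω, rfl⟩ : ∃ p ω', ω = p :: ω' := by
    cases ω with
    | nil => simp at hω
    | cons p ω => exact ⟨p, ω, rfl⟩
  simp only [List.map_cons, List.cons.injEq] at hω
  obtain ⟨ω', h1, h2⟩ := h ω hω.2
  exact ⟨p :: ω', by simp [h1, hω.1], by rw [prodU_cons, prodU_cons, h2]⟩

lemma transportsTo_of_eq_two {i j : I} (h : M i j = 2) (l : List I) :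
    TransportsTo M K (i :: j :: l) (j :: i :: l) := by
  rintro (_ | ⟨⟨i', a⟩, _ | ⟨⟨j', b⟩, ω⟩⟩) hω <;> simp at hω
  obtain ⟨rfl, rfl, rfl⟩ := hω
  refine ⟨(j', b) :: (i', a) :: ω, by simp, ?_⟩
  simp only [prodU_cons, ← mul_assoc, genU_mul_comm h]

lemma transportsTo_of_eq_three {i j : I} (h : M i j = 3) (l : List I) :
    TransportsTo M K (i :: j :: i :: l) (j :: i :: j :: l) := by
  rintro (_ | ⟨⟨i', a⟩, _ | ⟨⟨j', b⟩, _ | ⟨⟨i'', c⟩, ω⟩⟩⟩) hω <;> simp at hω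
  obtain ⟨rfl, rfl, rfl, rfl⟩ := hω
  refine ⟨(j', b + c - kmin a c) :: (i'', kmin a c) :: (j', a + b - kmin a c) :: ω, by simp, ?_⟩
  simp only [prodU_cons, ← mul_assoc, genU_braid h]

/-- Any two reduced words of the same element are related by braid moves, which transport
exponents. -/
theorem transportsTo_of_isReduced (cs : CoxeterSystem M W) (hM : IsSimplyLaced M) :
    ∀ (n : ℕ) (l l' : List I), l.length = n → cs.IsReduced l → cs.IsReduced l' →
      cs.wordProd l = cs.wordProd l' → TransportsTo M K l l' := by
  intro n
  induction n with
  | zero =>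
    intro l l' hn hl hl' hw
    have : l'.length = 0 := by rw [← hl'.eq, ← hw, hl.eq, hn]
    rw [List.length_eq_zero_iff] at hn this
    subst hn this
    exact fun ω hω => ⟨ω, hω, rfl⟩
  | succ n ih =>
    intro l l' hn hl hl' hw
    have hn' : l'.length = n + 1 := by rw [← hl'.eq, ← hw, hl.eq, hn]
    obtain ⟨i, t, rfl⟩ := List.exists_cons_of_length_eq_add_one hn
    obtain ⟨j, t', rfl⟩ := List.exists_cons_of_length_eq_add_one hn'
    simp only [List.length_cons, Nat.add_right_cancel_iff] at hn hn'
    have ht := (isReduced_cons_iff cs).1 hl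
    have ht' := (isReduced_cons_iff cs).1 hl'
    rw [cs.wordProd_cons, cs.wordProd_cons] at hw
    by_cases hij : i = j
    · subst hij
      exact (ih t t' hn ht.1 ht'.1 (mul_left_cancel hw)).cons i
    have hi := rhoOrbit_pos cs hM _ _ rfl i ht.2
    have hj := rhoOrbit_pos cs hM _ _ rfl j ht'.2
    set v := cs.wordProd t with hv
    have hv' : cs.wordProd t' = cs.simple j * (cs.simple i * v) := by rw [hw]; simp
    rw [hv', rhoOrbit_simple_mul_self] at hj
    have reduced_of_eq {u : List I} (hu : u.length = n)
        (huw : cs.wordProd u = cs.wordProd t') : cs.IsReduced u := by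
      rw [CoxeterSystem.IsReduced, huw, ht'.1.eq, hn', hu]
    have length_eq {u : List I} (hu : cs.IsReduced u) (huw : cs.wordProd u = v) :
        u.length = n := by
      rw [← hu.eq, huw, ht.1.eq, hn]
    rcases hM i j hij with h | h
    · rw [rhoOrbit_simple_mul_of_eq_two cs hM h] at hj
      obtain ⟨u, hu, huw⟩ := exists_isReduced_cons cs
        ((rhoOrbit_neg_iff cs hM (w := v) (i := j)).1 (by linarith))
      have hiu : cs.wordProd (i :: u) = cs.wordProd t' := by
        rw [hv', ← huw]
        simp only [cs.wordProd_cons, simple_mul_simple_mul_of_eq_two cs h]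
        simp
      exact ((ih t _ hn ht.1 hu huw.symm).cons i).trans <|
        (transportsTo_of_eq_two h u).trans <|
        (ih (i :: u) t' (length_eq hu huw :) (reduced_of_eq (length_eq hu huw :) hiu)
          ht'.1 hiu).cons j
    · have h' : M j i = 3 := (M.symmetric j i).trans h
      rw [rhoOrbit_simple_mul_of_eq_three cs hM h] at hj
      obtain ⟨u₁, hu₁, huw₁⟩ := exists_isReduced_cons cs
        ((rhoOrbit_neg_iff cs hM (w := v) (i := j)).1 (by linarith))
      have hdesc : rhoOrbit cs hM (cs.wordProd u₁) i < 0 := by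
        have : cs.wordProd u₁ = cs.simple j * v := by rw [← huw₁, cs.wordProd_cons]; simp
        rw [this, rhoOrbit_simple_mul_of_eq_three cs hM h']
        linarith
      obtain ⟨u, hu, huw⟩ := exists_isReduced_cons cs ((rhoOrbit_neg_iff cs hM).1 hdesc)
      have hjiu : cs.wordProd (j :: i :: u) = v := by
        rw [cs.wordProd_cons, huw, ← huw₁, cs.wordProd_cons]
      have hjiu_len : (j :: i :: u).length = n := by
        rw [← length_eq hu₁ huw₁, List.length_cons, ← hu.eq, huw,
          ((isReduced_cons_iff cs).1 hu₁).1.eq, List.length_cons]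
      have hjiu_red : cs.IsReduced (j :: i :: u) := by
        rw [CoxeterSystem.IsReduced, hjiu, ht.1.eq, hn, hjiu_len]
      have hiju : cs.wordProd (i :: j :: u) = cs.wordProd t' := by
        rw [hv', ← hjiu]
        simp only [cs.wordProd_cons, simple_mul_simple_mul_of_eq_three cs h]
        simp
      exact ((ih t _ hn ht.1 hjiu_red hjiu.symm).cons i).trans <|
        (transportsTo_of_eq_three h u).trans <|
        (ih (i :: j :: u) t' hjiu_len (reduced_of_eq hjiu_len hiju) ht'.1 hiju).cons j

end Transport

/-! ### Integral factors and their braid identities -/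

section IntegralFactor

open Set

/-- The factor `1 + ξ ∫₀ᵗ p` on `[0, ∞)`, extended by `1` to negative times. -/
noncomputable def integralFactor (ξ : ℝ) (p : ℝ → ℝ) (t : ℝ) : ℝ :=
  1 + ξ * ∫ s in (0 : ℝ)..max t 0, p s

lemma integralFactor_max (ξ : ℝ) (p : ℝ → ℝ) (t : ℝ) :
    integralFactor ξ p (max t 0) = integralFactor ξ p t := by
  simp [integralFactor]

lemma integralFactor_zero_right (ξ : ℝ) (p : ℝ → ℝ) : integralFactor ξ p 0 = 1 := by
  simp [integralFactor]

lemma hasDerivWithinAt_integralFactor {ξ : ℝ} {p : ℝ → ℝ} (hp : Continuous p) {x : ℝ}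
    (hx : 0 ≤ x) : HasDerivWithinAt (integralFactor ξ p) (ξ * p x) (Ici x) x := by
  have h : HasDerivAt (fun t => 1 + ξ * ∫ s in (0 : ℝ)..t, p s) (ξ * p x) x :=
    ((hp.integral_hasStrictDerivAt 0 x).hasDerivAt.const_mul ξ).const_add 1
  refine h.hasDerivWithinAt.congr (fun y hy => ?_) ?_
  · rw [integralFactor, max_eq_left (hx.trans hy)]
  · rw [integralFactor, max_eq_left hx]

lemma continuous_integralFactor {ξ : ℝ} {p : ℝ → ℝ} (hp : Continuous p) :
    Continuous (integralFactor ξ p) := by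
  have h : Continuous fun t => ∫ s in (0 : ℝ)..t, p s :=
    intervalIntegral.continuous_primitive (fun a b => hp.intervalIntegrable a b) 0
  exact continuous_const.add
    (continuous_const.mul (h.comp (continuous_id.max continuous_const)))

lemma integralFactor_pos {ξ : ℝ} (hξ : 0 ≤ ξ) {p : ℝ → ℝ} (hp : ∀ t, 0 < p t) (t : ℝ) :
    0 < integralFactor ξ p t := by
  have : 0 ≤ ∫ s in (0 : ℝ)..max t 0, p s :=
    intervalIntegral.integral_nonneg (le_max_right _ _) fun s _ => (hp s).le
  have := mul_nonneg hξ this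
  rw [integralFactor]
  linarith

lemma eq_of_hasDerivWithinAt_Ici {f g f' g' : ℝ → ℝ} (hf : Continuous f) (hg : Continuous g)
    (hf' : ∀ x, 0 ≤ x → HasDerivWithinAt f (f' x) (Ici x) x)
    (hg' : ∀ x, 0 ≤ x → HasDerivWithinAt g (g' x) (Ici x) x)
    (hfg : ∀ x, 0 ≤ x → f' x = g' x) (h0 : f 0 = g 0) {t : ℝ} (ht : 0 ≤ t) : f t = g t := by
  refine eq_of_has_deriv_right_eq (f' := f') (b := t) (fun x hx => hf' x hx.1) (fun x hx => ?_)
    hf.continuousOn hg.continuousOn h0 t ⟨ht, le_rfl⟩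
  rw [hfg x hx.1]
  exact hg' x hx.1

lemma integralFactor_add {a b : ℝ} (hb : 0 ≤ b) {p : ℝ → ℝ} (hp : Continuous p)
    (hp0 : ∀ t, 0 < p t) (t : ℝ) :
    integralFactor b p t *
        integralFactor a (fun s => p s * integralFactor b p s ^ (-2 : ℤ)) t =
      integralFactor (a + b) p t := by
  have hq := integralFactor_pos hb hp0
  have hqc := continuous_integralFactor (ξ := b) hp
  have hpc : Continuous fun s => p s * integralFactor b p s ^ (-2 : ℤ) :=
    hp.mul (hqc.zpow₀ _ fun s => Or.inl (hq s).ne')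
  wlog ht : 0 ≤ t generalizing t
  · simpa only [integralFactor_max] using this (max t 0) (le_max_right _ _)
  have key := eq_of_hasDerivWithinAt_Ici
    (f := integralFactor a fun s => p s * integralFactor b p s ^ (-2 : ℤ))
    (g := fun s => integralFactor (a + b) p s / integralFactor b p s)
    (continuous_integralFactor hpc)
    ((continuous_integralFactor hp).div hqc fun s => (hq s).ne')
    (fun x hx => hasDerivWithinAt_integralFactor hpc hx)
    (fun x hx => (hasDerivWithinAt_integralFactor hp hx).div
      (hasDerivWithinAt_integralFactor hp hx) (hq x).ne')
    (fun x hx => ?_) (by simp [integralFactor_zero_right]) ht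
  · rw [key, mul_div_cancel₀ _ (hq t).ne']
  · have := (hq x).ne'
    rw [zpow_neg]
    field_simp
    simp only [integralFactor]
    ring

lemma integralFactor_braid_aux {a b c a' c' : ℝ} (hsum : c' = a + c)
    (hprod : a' * c' = a * b) {p r : ℝ → ℝ} (hp : Continuous p) (hr : Continuous r)
    {t : ℝ} (ht : 0 ≤ t) :
    c' * integralFactor a' r t * integralFactor c p t -
        c * integralFactor c' (fun s => p s * integralFactor a' r s) t =
      a * integralFactor b (fun s => r s * integralFactor c p s) t := by
  have hr₁ : Continuous (integralFactor a' r) := continuous_integralFactor hr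
  have hq₁ : Continuous (integralFactor c p) := continuous_integralFactor hp
  refine eq_of_hasDerivWithinAt_Ici
    (f := fun t => c' * integralFactor a' r t * integralFactor c p t -
        c * integralFactor c' (fun s => p s * integralFactor a' r s) t)
    (g := fun t => a * integralFactor b (fun s => r s * integralFactor c p s) t)
    (((continuous_const.mul hr₁).mul hq₁).sub
      (continuous_const.mul (continuous_integralFactor (hp.mul hr₁))))
    (continuous_const.mul (continuous_integralFactor (hr.mul hq₁)))
    (fun x hx => (((hasDerivWithinAt_integralFactor hr hx).const_mul c').mul
      (hasDerivWithinAt_integralFactor hp hx)).sub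
        ((hasDerivWithinAt_integralFactor (hp.mul hr₁) hx).const_mul c))
    (fun x hx => (hasDerivWithinAt_integralFactor (hr.mul hq₁) hx).const_mul a)
    (fun x hx => ?_) ?_ ht
  · simp only [Pi.mul_apply]
    linear_combination (r x * integralFactor c p x) * hprod
  · simp only [integralFactor_zero_right]
    linear_combination hsum

lemma integralFactor_braid {a b c : ℝ} (hc : 0 ≤ c) {a' c' : ℝ}
    (hsum : c' = a + c) (hprod : a' * c' = a * b) {p r : ℝ → ℝ}
    (hp : Continuous p) (hr : Continuous r) (hp0 : ∀ t, 0 < p t) (t : ℝ) :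
    integralFactor c p t *
        integralFactor a (fun s => p s * integralFactor c p s ^ (-2 : ℤ) *
          integralFactor b (fun s => r s * integralFactor c p s) s) t =
      integralFactor c' (fun s => p s * integralFactor a' r s) t := by
  have hq := integralFactor_pos hc hp0
  have hqc : Continuous (integralFactor c p) := continuous_integralFactor hp
  have hr₁ : Continuous (integralFactor a' r) := continuous_integralFactor hr
  have hpc : Continuous fun s => p s * integralFactor c p s ^ (-2 : ℤ) *
      integralFactor b (fun s => r s * integralFactor c p s) s :=
    (hp.mul (hqc.zpow₀ _ fun s => Or.inl (hq s).ne')).mul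
      (continuous_integralFactor (hr.mul hqc))
  wlog ht : 0 ≤ t generalizing t
  · simpa only [integralFactor_max] using this (max t 0) (le_max_right _ _)
  have key := eq_of_hasDerivWithinAt_Ici
    (g := fun s => integralFactor c' (fun s => p s * integralFactor a' r s) s /
      integralFactor c p s)
    (continuous_integralFactor hpc)
    ((continuous_integralFactor (hp.mul hr₁)).div hqc fun s => (hq s).ne')
    (fun x hx => hasDerivWithinAt_integralFactor (ξ := a) hpc hx)
    (fun x hx => (hasDerivWithinAt_integralFactor (hp.mul hr₁) hx).div
      (hasDerivWithinAt_integralFactor hp hx) (hq x).ne')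
    (fun x hx => ?_) (by simp [integralFactor_zero_right]) ht
  · rw [key, mul_div_cancel₀ _ (hq t).ne']
  · have := (hq x).ne'
    have haux := integralFactor_braid_aux hsum hprod hp hr hx
    rw [zpow_neg]
    field_simp
    simp only [Pi.mul_apply]
    linear_combination (-p x) * haux

/-- If `p` has exponential growth rate `c > 0`, so has `1 + ξ ∫ p`. -/
lemma isTheta_integralFactor {ξ c : ℝ} (hξ : 0 < ξ) (hc : 0 < c) {p : ℝ → ℝ}
    (hp : Continuous p) (hp0 : ∀ t, 0 < p t)
    (h : p =Θ[Filter.principal (Ici 0)] fun t => Real.exp (c * t)) :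
    integralFactor ξ p =Θ[Filter.principal (Ici 0)] fun t => Real.exp (c * t) := by
  have hint (t : ℝ) : ∫ s in (0 : ℝ)..t, Real.exp (c * s) = (Real.exp (c * t) - 1) / c := by
    rw [intervalIntegral.integral_comp_mul_left (fun x => Real.exp x) hc.ne', integral_exp]
    simp [div_eq_inv_mul]
  have hexpc : Continuous fun t => Real.exp (c * t) := by fun_prop
  obtain ⟨⟨D, hD⟩, ⟨E, hE⟩⟩ := And.imp Asymptotics.IsBigO.exists_pos
    Asymptotics.IsBigO.exists_pos h
  rw [Asymptotics.isBigOWith_principal] at hD hE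
  obtain ⟨hD0, hD⟩ := hD
  obtain ⟨hE0, hE⟩ := hE
  simp only [Real.norm_eq_abs, Real.abs_exp, abs_of_pos (hp0 _)] at hD hE
  have hone (t : ℝ) (ht : t ∈ Ici (0 : ℝ)) : 1 ≤ Real.exp (c * t) :=
    Real.one_le_exp (mul_nonneg hc.le ht)
  constructor
  · refine .of_bound (1 + ξ * (D / c)) (Filter.eventually_principal.2 fun t ht => ?_)
    have ht' := hone t ht
    rw [Real.norm_eq_abs, Real.norm_eq_abs, Real.abs_exp,
      abs_of_pos (integralFactor_pos hξ.le hp0 t), integralFactor, max_eq_left ht]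
    have hle : ∫ s in (0 : ℝ)..t, p s ≤ D * ((Real.exp (c * t) - 1) / c) := by
      rw [← hint, ← intervalIntegral.integral_const_mul]
      exact intervalIntegral.integral_mono_on ht (hp.intervalIntegrable _ _)
        ((continuous_const.mul hexpc).intervalIntegrable _ _) fun s hs => hD s hs.1
    calc 1 + ξ * ∫ s in (0 : ℝ)..t, p s
        ≤ 1 + ξ * (D * ((Real.exp (c * t) - 1) / c)) := by gcongr
      _ = 1 + ξ * (D / c) * (Real.exp (c * t) - 1) := by ring
      _ ≤ (1 + ξ * (D / c)) * Real.exp (c * t) := by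
        have : 0 < ξ * (D / c) := by positivity
        linarith
  · refine .of_bound (1 + E * c / ξ) (Filter.eventually_principal.2 fun t ht => ?_)
    have ht' := hone t ht
    rw [Real.norm_eq_abs, Real.norm_eq_abs, Real.abs_exp,
      abs_of_pos (integralFactor_pos hξ.le hp0 t), integralFactor, max_eq_left ht]
    have hle : (Real.exp (c * t) - 1) / c ≤ E * ∫ s in (0 : ℝ)..t, p s := by
      rw [← hint, ← intervalIntegral.integral_const_mul]
      exact intervalIntegral.integral_mono_on ht (hexpc.intervalIntegrable _ _)
        ((continuous_const.mul hp).intervalIntegrable _ _) fun s hs => hE s hs.1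
    rw [div_le_iff₀ hc] at hle
    have hnn : 0 ≤ ∫ s in (0 : ℝ)..t, p s :=
      intervalIntegral.integral_nonneg ht fun s _ => (hp0 s).le
    have : (1 + E * c / ξ) * (1 + ξ * ∫ s in (0 : ℝ)..t, p s) =
        1 + E * (∫ s in (0 : ℝ)..t, p s) * c + (E * c / ξ + ξ * ∫ s in (0 : ℝ)..t, p s) := by
      field_simp
      ring
    rw [this]
    have : 0 ≤ E * c / ξ + ξ * ∫ s in (0 : ℝ)..t, p s := by positivity
    linarith

end IntegralFactor

/-! ### The action of positive root subgroups on families of positive curves -/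

section RootAction

open Set Filter Topology
open scoped NNReal

variable {I : Type*} {M : CoxeterMatrix I}

/-- Continuous positive real functions of time. -/
abbrev PosCurve := {f : ℝ → ℝ // Continuous f ∧ ∀ t, 0 < f t}

variable (M) in
/-- The action of the root subgroup element `xᵢ(ξ)` on families of positive curves, describing
the exponentials of the simple roots along a path in the Cartan subalgebra. -/
noncomputable def rootAct (i : I) (ξ : ℝ≥0) (p : I → PosCurve) : I → PosCurve := fun k =>
  ⟨fun t => (p k).1 t * integralFactor ξ (p i).1 t ^ negCartan M i k,
    have hpos := integralFactor_pos ξ.2 (p i).2.2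
    ⟨(p k).2.1.mul ((continuous_integralFactor (p i).2.1).zpow₀ _ fun s => Or.inl (hpos s).ne'),
      fun t => mul_pos ((p k).2.2 t) (zpow_pos (hpos t) _)⟩⟩

lemma rootAct_apply (i : I) (ξ : ℝ≥0) (p : I → PosCurve) (k : I) :
    (rootAct M i ξ p k).1 =
      fun t => (p k).1 t * integralFactor ξ (p i).1 t ^ negCartan M i k := rfl

lemma rootAct_comm {i j : I} (h : M i j = 2) (a b : ℝ≥0) (p : I → PosCurve) :
    rootAct M i a (rootAct M j b p) = rootAct M j b (rootAct M i a p) := by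
  have h' : M j i = 2 := (M.symmetric j i).trans h
  funext k
  refine Subtype.ext (funext fun t => ?_)
  simp only [rootAct_apply, negCartan_of_eq_two h, negCartan_of_eq_two h', zpow_zero, mul_one]
  ring

lemma rootAct_rootAct (i : I) (a b : ℝ≥0) (p : I → PosCurve) :
    rootAct M i a (rootAct M i b p) = rootAct M i (a + b) p := by
  funext k
  refine Subtype.ext (funext fun t => ?_)
  simp only [rootAct_apply, negCartan_self, NNReal.coe_add]
  rw [mul_assoc, ← mul_zpow, integralFactor_add b.coe_nonneg (p i).2.1 (p i).2.2]

lemma rootAct_braid {i j : I} (h : M i j = 3) {a b c : ℝ≥0} (ha : 0 < a) (hb : 0 < b)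
    (p : I → PosCurve) :
    rootAct M i a (rootAct M j b (rootAct M i c p)) =
      rootAct M j (b * c / (a + c)) (rootAct M i (a + c)
        (rootAct M j (a * b / (a + c)) p)) := by
  have h' : M j i = 3 := (M.symmetric j i).trans h
  have ha' : (0 : ℝ) < a := ha
  have hb' : (0 : ℝ) < b := hb
  have hc' : (0 : ℝ) ≤ c := c.2
  funext k
  refine Subtype.ext (funext fun t => ?_)
  simp only [rootAct_apply, negCartan_self, negCartan_of_eq_three h, negCartan_of_eq_three h',
    zpow_one, NNReal.coe_add, NNReal.coe_mul, NNReal.coe_div]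
  have h1 := integralFactor_braid (a := a) (b := b) (c := c) (a' := a * b / (a + c))
    (c' := a + c) hc' rfl (by field_simp) (p i).2.1 (p j).2.1 (p i).2.2 t
  have h2 := integralFactor_braid (a := b * c / (a + c)) (b := a + c) (c := a * b / (a + c))
    (a' := c) (c' := b) (by positivity) (by field_simp; ring) (by field_simp)
    (p j).2.1 (p i).2.1 (p j).2.2 t
  rw [← h1, ← h2, mul_zpow, mul_zpow]
  ring

/-- The curves `p k` have exponential growth rates `c k`. -/
def HasGrowth (c : I → ℝ) (p : I → PosCurve) : Prop :=
  ∀ k, (p k).1 =Θ[𝓟 (Ici 0)] fun t => Real.exp (c k * t)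

lemma HasGrowth.rootAct {c : I → ℝ} {p : I → PosCurve} (h : HasGrowth c p) {i : I}
    (hi : 0 < c i) {ξ : ℝ≥0} (hξ : 0 < ξ) :
    HasGrowth (simpleReflection M i c) (rootAct M i ξ p) := by
  intro k
  rw [rootAct_apply]
  have hexp : (fun t => Real.exp (simpleReflection M i c k * t)) =
      fun t => Real.exp (c k * t) * Real.exp (c i * t) ^ negCartan M i k := by
    funext t
    rw [← Real.rpow_intCast, ← Real.exp_mul, ← Real.exp_add, simpleReflection]
    congr 1
    ring
  rw [hexp]
  exact (h k).mul ((isTheta_integralFactor (NNReal.coe_pos.2 hξ) hi (p i).2.1 (p i).2.2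
    (h i)).zpow (negCartan M i k))

lemma integralFactor_neg_mul_rootAct (i : I) (a : ℝ≥0) (p : I → PosCurve) (t : ℝ) :
    integralFactor a (p i).1 t * integralFactor (-a) (rootAct M i a p i).1 t = 1 := by
  rw [rootAct_apply, negCartan_self, integralFactor_add a.coe_nonneg (p i).2.1 (p i).2.2]
  simp [integralFactor]

lemma HasGrowth.tendsto_integralFactor_rootAct {c : I → ℝ} {p : I → PosCurve}
    (h : HasGrowth c p) {i : I} (hi : 0 < c i) {a : ℝ≥0} (ha : 0 < a) :
    Tendsto (integralFactor (-a) (_root_.rootAct M i a p i).1) atTop (𝓝 0) := by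
  have hθ := (isTheta_integralFactor (NNReal.coe_pos.2 ha) hi (p i).2.1 (p i).2.2 (h i)).mono
    (le_principal_iff.2 (Ici_mem_atTop 0) : atTop ≤ 𝓟 (Ici (0 : ℝ)))
  have hexp : Tendsto (fun t => Real.exp (c i * t)) atTop atTop :=
    Real.tendsto_exp_atTop.comp (tendsto_id.const_mul_atTop hi)
  have hnorm := hθ.tendsto_norm_atTop_iff.2 (tendsto_norm_atTop_atTop.comp hexp)
  refine (tendsto_inv_atTop_zero.comp hnorm).congr fun t => ?_
  have hpos := integralFactor_pos a.coe_nonneg (p i).2.2 t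
  rw [Function.comp_apply, Function.comp_apply, Real.norm_of_nonneg hpos.le]
  exact inv_eq_of_mul_eq_one_right (integralFactor_neg_mul_rootAct i a p t)

/-- A root subgroup acts freely on curves of positive growth in the direction of the root. -/
lemma HasGrowth.rootAct_injective {c c' : I → ℝ} {p p' : I → PosCurve} (h : HasGrowth c p)
    (h' : HasGrowth c' p') {i : I} (hi : 0 < c i) (hi' : 0 < c' i) {a b : ℝ≥0} (ha : 0 < a)
    (hb : 0 < b) (hab : _root_.rootAct M i a p = _root_.rootAct M i b p') : a = b ∧ p = p' := by
  have hlim := h.tendsto_integralFactor_rootAct (M := M) hi ha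
  have hlim' := h'.tendsto_integralFactor_rootAct (M := M) hi' hb
  rw [← hab] at hlim'
  have hconst := (hlim.const_mul (b : ℝ)).sub (hlim'.const_mul (a : ℝ))
  have hab' : a = b := by
    have : (b : ℝ) - a = b * 0 - a * 0 :=
      tendsto_nhds_unique (tendsto_const_nhds.congr fun t => by
        simp only [integralFactor]; ring) hconst
    exact NNReal.coe_injective (by linarith)
  subst hab'
  refine ⟨rfl, ?_⟩
  have hq (t : ℝ) : integralFactor a (p i).1 t = integralFactor a (p' i).1 t := by
    have h1 := integralFactor_neg_mul_rootAct (M := M) i a p t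
    have h2 := integralFactor_neg_mul_rootAct (M := M) i a p' t
    rw [← hab] at h2
    exact mul_right_cancel₀ (right_ne_zero_of_mul_eq_one h1) (h1.trans h2.symm)
  funext k
  refine Subtype.ext (funext fun t => ?_)
  have := congrFun (congrArg Subtype.val (congrFun hab k)) t
  simp only [rootAct_apply, hq] at this
  exact mul_right_cancel₀ (zpow_pos (integralFactor_pos a.coe_nonneg (p' i).2.2 t) _).ne' this

end RootAction

/-! ### Lifting `𝔘(K)` to families of root subgroup elements -/

section Lift

open Set Filter Asymptotics
open scoped NNReal Pointwise

variable {I W : Type*} [Group W] {M : CoxeterMatrix I} {K : AddSubgroup ℝ}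

/-- Sequences of positive reals with exponential decay rate `a`. -/
def positiveFamilies (a : ℝ) : Set (ℕ → ℝ≥0) :=
  {f | (∀ n, 0 < f n) ∧ (fun n => (f n : ℝ)) =Θ[atTop] fun n : ℕ => Real.exp (-(a * n))}

lemma positiveFamilies_nonempty (a : ℝ) : (positiveFamilies a).Nonempty :=
  ⟨fun n => ⟨Real.exp (-(a * n)), (Real.exp_pos _).le⟩, fun _ => Real.exp_pos _,
    isTheta_refl _ _⟩

lemma mul_mem_positiveFamilies {a b : ℝ} {f g : ℕ → ℝ≥0} (hf : f ∈ positiveFamilies a)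
    (hg : g ∈ positiveFamilies b) : f * g ∈ positiveFamilies (a + b) := by
  refine ⟨fun n => mul_pos (hf.1 n) (hg.1 n), ?_⟩
  have := hf.2.mul hg.2
  simpa only [Pi.mul_apply, NNReal.coe_mul, ← Real.exp_add, ← neg_add, ← add_mul] using this

lemma div_mem_positiveFamilies {a b : ℝ} {f g : ℕ → ℝ≥0} (hf : f ∈ positiveFamilies a)
    (hg : g ∈ positiveFamilies b) : f / g ∈ positiveFamilies (a - b) := by
  refine ⟨fun n => div_pos (hf.1 n) (hg.1 n), ?_⟩
  have := hf.2.div hg.2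
  refine this.trans_eventuallyEq (.of_forall fun n => ?_)
  simp only
  rw [← Real.exp_sub]
  congr 1
  ring

lemma isBigO_add_right {f g : ℕ → ℝ≥0} :
    (fun n => (f n : ℝ)) =O[atTop] fun n => ((f + g) n : ℝ) :=
  isBigO_of_le _ fun n => by
    simp only [NNReal.norm_eq, Pi.add_apply, NNReal.coe_le_coe]
    exact le_self_add

lemma isBigO_exp_neg_mul {a b : ℝ} (h : b ≤ a) :
    (fun n : ℕ => Real.exp (-(a * n))) =O[atTop] fun n : ℕ => Real.exp (-(b * n)) :=
  isBigO_of_le _ fun n => by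
    rw [Real.norm_of_nonneg (Real.exp_pos _).le, Real.norm_of_nonneg (Real.exp_pos _).le]
    gcongr

lemma add_mem_positiveFamilies {a b : ℝ} {f g : ℕ → ℝ≥0} (hf : f ∈ positiveFamilies a)
    (hg : g ∈ positiveFamilies b) : f + g ∈ positiveFamilies (min a b) := by
  refine ⟨fun n => add_pos (hf.1 n) (hg.1 n), ?_, ?_⟩
  · simpa only [Pi.add_apply, NNReal.coe_add] using
      (hf.2.1.trans (isBigO_exp_neg_mul (min_le_left a b))).add
        (hg.2.1.trans (isBigO_exp_neg_mul (min_le_right a b)))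
  · rcases min_choice a b with h | h <;> rw [h]
    · exact hf.2.2.trans isBigO_add_right
    · exact hg.2.2.trans (by rw [add_comm f g]; exact isBigO_add_right)

lemma exists_add_eq_of_mem_positiveFamilies {a b : ℝ} {f : ℕ → ℝ≥0}
    (hf : f ∈ positiveFamilies (min a b)) :
    ∃ g ∈ positiveFamilies a, ∃ h ∈ positiveFamilies b, g + h = f := by
  obtain ⟨g, hg⟩ := positiveFamilies_nonempty a
  obtain ⟨h, hh⟩ := positiveFamilies_nonempty b
  have hf' := div_mem_positiveFamilies hf (add_mem_positiveFamilies hg hh)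
  rw [sub_self] at hf'
  refine ⟨g * (f / (g + h)), add_zero a ▸ mul_mem_positiveFamilies hg hf',
    h * (f / (g + h)), add_zero b ▸ mul_mem_positiveFamilies hh hf', ?_⟩
  rw [← add_mul]
  exact funext fun n => mul_div_cancel₀ _ (add_pos (hg.1 n) (hh.1 n)).ne'

lemma eq_of_mem_positiveFamilies {a b : ℝ} {f : ℕ → ℝ≥0} (hf : f ∈ positiveFamilies a)
    (hf' : f ∈ positiveFamilies b) : a = b := by
  have aux {a b : ℝ} (hf : f ∈ positiveFamilies a) (hf' : f ∈ positiveFamilies b) : b ≤ a := by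
    by_contra! hab
    have ho : (fun n : ℕ => Real.exp (-(b * n))) =o[atTop] fun n : ℕ => Real.exp (-(a * n)) := by
      rw [Real.isLittleO_exp_comp_exp_comp]
      simpa only [neg_sub_neg, ← sub_mul] using
        tendsto_natCast_atTop_atTop.const_mul_atTop (sub_pos.2 hab)
    exact ho.not_isBigO (Frequently.of_forall fun n => (Real.exp_pos _).ne')
      (hf.2.2.trans hf'.2.1)
  exact le_antisymm (aux hf' hf) (aux hf hf')

variable (M) in
/-- The lift of the generator `i^a` to families of root subgroup elements. -/
def genFamilies (i : I) (a : ℝ) : Set (ℕ → Function.End (I → PosCurve)) :=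
  (fun f n => (rootAct M i (f n) : Function.End (I → PosCurve))) '' positiveFamilies a

lemma genFamilies_mul_comm {i j : I} (h : M i j = 2) (a b : ℝ) :
    genFamilies M i a * genFamilies M j b = genFamilies M j b * genFamilies M i a := by
  have aux {i j : I} (h : M i j = 2) (a b : ℝ) :
      genFamilies M i a * genFamilies M j b ⊆ genFamilies M j b * genFamilies M i a := by
    rintro _ ⟨_, ⟨f, hf, rfl⟩, _, ⟨g, hg, rfl⟩, rfl⟩
    exact ⟨_, ⟨g, hg, rfl⟩, _, ⟨f, hf, rfl⟩,
      funext fun n => funext fun p => (rootAct_comm h (f n) (g n) p).symm⟩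
  exact (aux h a b).antisymm (aux ((M.symmetric j i).trans h) b a)

lemma genFamilies_mul_self (i : I) (a b : ℝ) :
    genFamilies M i a * genFamilies M i b = genFamilies M i (min a b) := by
  apply Subset.antisymm
  · rintro _ ⟨_, ⟨f, hf, rfl⟩, _, ⟨g, hg, rfl⟩, rfl⟩
    exact ⟨f + g, add_mem_positiveFamilies hf hg,
      funext fun n => funext fun p => (rootAct_rootAct i (f n) (g n) p).symm⟩
  · rintro _ ⟨_, hf, rfl⟩
    obtain ⟨g, hg, h, hh, rfl⟩ := exists_add_eq_of_mem_positiveFamilies hf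
    exact ⟨_, ⟨g, hg, rfl⟩, _, ⟨h, hh, rfl⟩,
      funext fun n => funext fun p => rootAct_rootAct i (g n) (h n) p⟩

lemma genFamilies_braid_subset {i j : I} (h : M i j = 3) (a b c : ℝ) :
    genFamilies M i a * genFamilies M j b * genFamilies M i c ⊆
      genFamilies M j (b + c - min a c) * genFamilies M i (min a c) *
        genFamilies M j (a + b - min a c) := by
  rintro _ ⟨_, ⟨_, ⟨f, hf, rfl⟩, _, ⟨g, hg, rfl⟩, rfl⟩, _, ⟨k, hk, rfl⟩, rfl⟩
  have hfk := add_mem_positiveFamilies hf hk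
  exact ⟨_, ⟨_, ⟨_, div_mem_positiveFamilies (mul_mem_positiveFamilies hg hk) hfk, rfl⟩,
    _, ⟨_, hfk, rfl⟩, rfl⟩,
    _, ⟨_, div_mem_positiveFamilies (mul_mem_positiveFamilies hf hg) hfk, rfl⟩,
    funext fun n => funext fun p => (rootAct_braid h (hf.1 n) (hg.1 n) p).symm⟩

lemma genFamilies_braid {i j : I} (h : M i j = 3) (a b c : ℝ) :
    genFamilies M i a * genFamilies M j b * genFamilies M i c =
      genFamilies M j (b + c - min a c) * genFamilies M i (min a c) *
        genFamilies M j (a + b - min a c) := by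
  refine (genFamilies_braid_subset h a b c).antisymm ?_
  have hmin : min (b + c - min a c) (a + b - min a c) = b := by
    rw [min_sub_sub_right, add_comm b, min_add_add_right, min_comm c, add_sub_cancel_left]
  have := genFamilies_braid_subset ((M.symmetric j i).trans h)
    (b + c - min a c) (min a c) (a + b - min a c)
  rwa [hmin, show min a c + (a + b - min a c) - b = a by ring,
    show b + c - min a c + min a c - b = c by ring] at this

lemma coe_kmin (a b : K) : (kmin a b : ℝ) = min (a : ℝ) b := by
  rw [kmin, min_def]
  split_ifs <;> rfl

variable (M K) in
/-- The lift of `𝔘(K)` to sets of families of transformations of positive curves. -/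
noncomputable def liftU : UK M K →* Set (ℕ → Function.End (I → PosCurve)) :=
  Con.lift (conGen (UKRel M K)) (FreeMonoid.lift fun p => genFamilies M p.1 p.2) <|
    Con.conGen_le.2 fun x y h => by
      rw [Con.ker_rel]
      cases h with
      | comm i j h a b => simp [genFamilies_mul_comm h]
      | braid i j h a b c => simp [genFamilies_braid h, coe_kmin]
      | idem i a b => simp [genFamilies_mul_self, coe_kmin]

lemma liftU_genU (i : I) (a : K) : liftU M K (genU M K i a) = genFamilies M i a :=
  FreeMonoid.lift_eval_of (fun p : I × K => genFamilies M p.1 p.2) (i, a)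

lemma mem_liftU_prodU_cons {p : I × K} {ω : List (I × K)}
    {g : ℕ → Function.End (I → PosCurve)} :
    g ∈ liftU M K (prodU M K (p :: ω)) ↔ ∃ f ∈ positiveFamilies p.2,
      ∃ h ∈ liftU M K (prodU M K ω), (fun n => rootAct M p.1 (f n) ∘ h n) = g := by
  rw [prodU_cons, map_mul, liftU_genU]
  constructor
  · rintro ⟨_, ⟨f, hf, rfl⟩, h, hh, rfl⟩
    exact ⟨f, hf, h, hh, rfl⟩
  · rintro ⟨f, hf, h, hh, rfl⟩
    exact ⟨_, ⟨f, hf, rfl⟩, h, hh, rfl⟩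

lemma liftU_prodU_nonempty (ω : List (I × K)) : (liftU M K (prodU M K ω)).Nonempty := by
  induction ω with
  | nil => exact ⟨1, by simp [prodU]⟩
  | cons p ω ih =>
    obtain ⟨f, hf⟩ := positiveFamilies_nonempty p.2
    obtain ⟨h, hh⟩ := ih
    exact ⟨_, mem_liftU_prodU_cons.2 ⟨f, hf, h, hh, rfl⟩⟩

/-- The family of curves on which all simple roots grow with rate one. -/
noncomputable def baseCurve : I → PosCurve := fun _ =>
  ⟨Real.exp, Real.continuous_exp, Real.exp_pos⟩

lemma hasGrowth_baseCurve (cs : CoxeterSystem M W) (hM : IsSimplyLaced M) :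
    HasGrowth (rhoOrbit cs hM 1) baseCurve := fun k => by
  simp only [rhoOrbit_one, one_mul]
  exact isTheta_refl Real.exp _

lemma hasGrowth_of_mem_liftU (cs : CoxeterSystem M W) (hM : IsSimplyLaced M)
    {ω : List (I × K)} (hω : cs.IsReduced (ω.map Prod.fst))
    {g : ℕ → Function.End (I → PosCurve)} (hg : g ∈ liftU M K (prodU M K ω)) (n : ℕ) :
    HasGrowth (rhoOrbit cs hM (cs.wordProd (ω.map Prod.fst))) (g n baseCurve) := by
  induction ω generalizing g with
  | nil =>
    obtain rfl : g = 1 := by simpa [prodU] using hg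
    rw [List.map_nil, cs.wordProd_nil]
    exact hasGrowth_baseCurve cs hM
  | cons p ω ih =>
    obtain ⟨f, hf, h, hh, rfl⟩ := mem_liftU_prodU_cons.1 hg
    rw [List.map_cons, isReduced_cons_iff] at hω
    rw [List.map_cons, cs.wordProd_cons, rhoOrbit_simple_mul]
    exact (ih hω.1 hh).rootAct (rhoOrbit_pos cs hM _ _ rfl _ hω.2) (hf.1 n)

lemma eq_of_mem_liftU (cs : CoxeterSystem M W) (hM : IsSimplyLaced M) {ω ω' : List (I × K)}
    (hω : cs.IsReduced (ω.map Prod.fst)) (hωω' : ω.map Prod.fst = ω'.map Prod.fst)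
    {g g' : ℕ → Function.End (I → PosCurve)} (hg : g ∈ liftU M K (prodU M K ω))
    (hg' : g' ∈ liftU M K (prodU M K ω')) (h : ∀ n, g n baseCurve = g' n baseCurve) :
    ω = ω' := by
  induction ω generalizing ω' g g' with
  | nil => exact (List.map_eq_nil_iff.1 hωω'.symm).symm
  | cons p ω ih =>
    obtain ⟨i, a⟩ := p
    obtain _ | ⟨⟨i', a'⟩, ω'⟩ := ω'
    · simp at hωω'
    simp only [List.map_cons, List.cons.injEq] at hωω'
    obtain ⟨rfl, hωω'⟩ := hωω'
    obtain ⟨f, hf, k, hk, rfl⟩ := mem_liftU_prodU_cons.1 hg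
    obtain ⟨f', hf', k', hk', rfl⟩ := mem_liftU_prodU_cons.1 hg'
    rw [List.map_cons, isReduced_cons_iff] at hω
    have hpos := rhoOrbit_pos cs hM _ _ rfl _ hω.2
    have key (n : ℕ) : f n = f' n ∧ k n baseCurve = k' n baseCurve :=
      (hasGrowth_of_mem_liftU cs hM hω.1 hk n).rootAct_injective
        (hasGrowth_of_mem_liftU cs hM (hωω' ▸ hω.1) hk' n) hpos (hωω' ▸ hpos)
        (hf.1 n) (hf'.1 n) (h n)
    obtain rfl : f = f' := funext fun n => (key n).1
    obtain rfl : a = a' := Subtype.ext (eq_of_mem_positiveFamilies hf hf')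
    rw [ih hω.1 hωω' hk hk' fun n => (key n).2]

/-- The exponents of a product in `𝔘(K)` along a reduced word are unique. -/
theorem eq_of_prodU_eq (cs : CoxeterSystem M W) (hM : IsSimplyLaced M) {ω ω' : List (I × K)}
    (hω : cs.IsReduced (ω.map Prod.fst)) (hωω' : ω.map Prod.fst = ω'.map Prod.fst)
    (h : prodU M K ω = prodU M K ω') : ω = ω' := by
  obtain ⟨g, hg⟩ := liftU_prodU_nonempty (M := M) ω
  exact eq_of_mem_liftU cs hM hω hωω' hg (h ▸ hg) fun _ => rfl

/-- The exponent of the first factor determines the remaining product. -/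
theorem prodU_eq_of_genU_mul_prodU_eq (cs : CoxeterSystem M W) (hM : IsSimplyLaced M)
    {i : I} {a : K} {ω ω' : List (I × K)} (hω : cs.IsReduced (i :: ω.map Prod.fst))
    (hω' : cs.IsReduced (i :: ω'.map Prod.fst))
    (hw : cs.wordProd (i :: ω.map Prod.fst) = cs.wordProd (i :: ω'.map Prod.fst))
    (h : genU M K i a * prodU M K ω = genU M K i a * prodU M K ω') :
    prodU M K ω = prodU M K ω' := by
  rw [cs.wordProd_cons, cs.wordProd_cons, mul_right_inj] at hw
  obtain ⟨ω'', hmap, hprod⟩ := transportsTo_of_isReduced cs hM _ _ _ rfl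
    ((isReduced_cons_iff cs).1 hω').1 ((isReduced_cons_iff cs).1 hω).1 hw.symm ω' rfl
  have hcons : (i, a) :: ω = (i, a) :: ω'' := by
    refine eq_of_prodU_eq cs hM hω (by simp [hmap]) ?_
    rw [prodU_cons, prodU_cons, hprod, h]
  rw [← hprod, (List.cons.inj hcons).2]

end Lift

/-- **No. 14** (Lusztig, "Half circles on flag manifolds over a semifield").
Fix a reduced word `(i₁, …, i_ν)` of `w₀`.  If `H, H' ∈ 𝒰(K₊)` admit descent chains
along `(i₁, …, i_ν)`, both ending at `𝐇 = i₁^0 ⋯ i_ν^0`, with the same tuple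
`(c₁, …, c_ν) ∈ K₊^ν`, then `H = H'`; that is, the map `ζ` sending `H` to the tuple of
its descent chain is injective. -/
theorem descentChain_tuple_injective
    {I W : Type*} [Finite I] [Nonempty I] [Group W] [Finite W]
    (M : CoxeterMatrix I) (hM : ∀ i j : I, i ≠ j → M i j = 2 ∨ M i j = 3)
    (cs : CoxeterSystem M W)
    (K : AddSubgroup ℝ) (hK : K ≠ ⊥)
    (ν : ℕ) (w₀ : W) (hw₀ : cs.length w₀ = ν) (hν : ∀ w : W, cs.length w ≤ ν)
    (l : List I) (hl : IsRedWord cs w₀ l)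
    (H H' : UK M K) (hH : H ∈ calUplus M K cs w₀) (hH' : H' ∈ calUplus M K cs w₀)
    (Hs Hs' : ℕ → UK M K) (c : ℕ → K)
    (hc : DescentChain M K cs w₀ l H Hs c) (hc' : DescentChain M K cs w₀ l H' Hs' c)
    (hend : Hs l.length = prodU M K (l.map fun i => (i, (0 : K))))
    (hend' : Hs' l.length = prodU M K (l.map fun i => (i, (0 : K)))) :
    H = H' := by
  have isReduced_of {u : List I} (hu : IsRedWord cs w₀ u) : cs.IsReduced u := by
    rw [CoxeterSystem.IsReduced, hu.1, hu.2]
  obtain ⟨h0, -, -, hstep⟩ := hc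
  obtain ⟨h0', -, -, hstep'⟩ := hc'
  have key : Hs 0 = Hs' 0 := by
    refine Nat.decreasingInduction' (P := fun k => Hs k = Hs' k) (fun k hk _ hnext => ?_)
      (Nat.zero_le l.length) (hend.trans hend'.symm)
    obtain ⟨ω, -, hω, hk1, hk2⟩ := hstep k hk
    obtain ⟨ω', -, hω', hk1', hk2'⟩ := hstep' k hk
    rw [hk1, hk1', prodU_eq_of_genU_mul_prodU_eq cs hM (isReduced_of hω) (isReduced_of hω')
      (hω.1.trans hω'.1.symm) (hk2.symm.trans (hnext.trans hk2'))]
  rw [← h0, key, h0']
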